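/- arXiv:cs/0611090 — 12 statements merged into one kernel-verified Lean document; each statement's English description precedes it below -/
import Mathlib

section
/- Let N ≥ 1, m ≥ 1 and 0 ≤ f ≤ mN be integers. Over all vectors (a_0, …, a_m) of nonnegative integers with Σ_{i=0}^m a_i = N and Σ_{i=0}^m i·a_i = f, the minimum of η = Σ_{i=0}^m a_i 2^{-i} equals 2^{-(q+1)}·((q+2)N − f), where q = ⌊f/N⌋; this minimum is attained by the pattern in which the f bit erasures are spread as evenly as possible, i.e., N − (f − qN) symbols contain q erasures and f − qN symbols contain q+1 erasures. -/
theorem sum_two_point_mul {R : Type*} [CommSemiring R] {m q x y : ℕ} (g : ℕ → R)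
    (hq : q ≤ m) (hy : q = m → y = 0) :
    ∑ i : Fin (m + 1),
      ((if (i : ℕ) = q then x else if (i : ℕ) = q + 1 then y else 0 : ℕ) : R) * g i =
      x * g q + y * g (q + 1) := by
  rw [Fin.sum_univ_eq_sum_range
    (fun i => ((if i = q then x else if i = q + 1 then y else 0 : ℕ) : R) * g i) (m + 1)]
  have hlast :
      ((if m + 1 = q then x else if m + 1 = q + 1 then y else 0 : ℕ) : R) * g (m + 1) = 0 := by
    rw [if_neg (by omega)]
    split_ifs with h
    · simp [hy (by omega)]
    · simp
  rw [← add_zero (∑ i ∈ Finset.range (m + 1), _), ← hlast,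
    ← Finset.sum_range_succ
      (fun i => ((if i = q then x else if i = q + 1 then y else 0 : ℕ) : R) * g i)]
  have hsplit : ∀ i ∈ Finset.range (m + 1 + 1),
      ((if i = q then x else if i = q + 1 then y else 0 : ℕ) : R) * g i =
        (if i = q then (x : R) * g q else 0) +
          (if i = q + 1 then (y : R) * g (q + 1) else 0) := by
    intro i _
    by_cases h : i = q
    · simp [h]
    · by_cases h' : i = q + 1 <;> simp [h, h']
  rw [Finset.sum_congr rfl hsplit, Finset.sum_add_distrib, Finset.sum_ite_eq',
    Finset.sum_ite_eq', if_pos (by simp; omega), if_pos (by simp; omega)]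

/-- The convex function `2^{-i}` lies above its chord through `q` and `q + 1` at integers. -/
theorem chord_le_half_pow (q i : ℕ) :
    (1 / 2 : ℝ) ^ (q + 1) * ((q : ℝ) + 2 - i) ≤ (1 / 2 : ℝ) ^ i := by
  rcases le_total i (q + 1) with h | h
  · obtain ⟨k, hk⟩ := Nat.exists_eq_add_of_le h
    have hk' : (q : ℝ) + 1 = i + k := by exact_mod_cast hk
    have hpow : (k : ℝ) + 1 ≤ 2 ^ k := by exact_mod_cast Nat.lt_two_pow_self
    rw [hk, pow_add, mul_assoc]
    refine mul_le_of_le_one_right (by positivity) ?_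
    rw [one_div, inv_pow, inv_mul_le_iff₀ (by positivity)]
    linarith
  · rcases h.eq_or_lt with h | h
    · rw [← h]
      push_cast
      exact le_of_eq (by ring)
    · have h' : (q : ℝ) + 2 ≤ i := by exact_mod_cast h
      exact (mul_nonpos_of_nonneg_of_nonpos (by positivity) (by linarith)).trans (by positivity)


/-- Over all erasure patterns `(a_0, …, a_m)` of nonnegative integers with `Σ aᵢ = N`
and total number of erased bits `Σ i·aᵢ = f`, the minimum of `η = Σ aᵢ 2^{-i}` equals
`2^{-(q+1)}·((q+2)N − f)` with `q = ⌊f/N⌋`, and it is attained by the pattern spreading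
the `f` erasures as evenly as possible: `N − (f − qN)` symbols of type `q` and
`f − qN` symbols of type `q+1`. -/
theorem worst_case_erasure_pattern_bec (N m f : ℕ) (hN : 1 ≤ N) (hm : 1 ≤ m)
    (hf : f ≤ m * N) :
    IsLeast
      {η : ℝ | ∃ a : Fin (m + 1) → ℕ, (∑ i : Fin (m + 1), a i) = N ∧
        (∑ i : Fin (m + 1), (i : ℕ) * a i) = f ∧
        η = ∑ i : Fin (m + 1), (a i : ℝ) * (1 / 2 : ℝ) ^ (i : ℕ)}
      ((1 / 2 : ℝ) ^ (f / N + 1) * (((f / N : ℕ) + 2) * N - f)) ∧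
    ((∑ i : Fin (m + 1),
        (fun i : Fin (m + 1) =>
          if (i : ℕ) = f / N then N - (f - (f / N) * N)
          else if (i : ℕ) = f / N + 1 then f - (f / N) * N else 0) i) = N ∧
      (∑ i : Fin (m + 1), (i : ℕ) *
        (fun i : Fin (m + 1) =>
          if (i : ℕ) = f / N then N - (f - (f / N) * N)
          else if (i : ℕ) = f / N + 1 then f - (f / N) * N else 0) i) = f ∧
      (∑ i : Fin (m + 1),
        ((fun i : Fin (m + 1) =>
          if (i : ℕ) = f / N then N - (f - (f / N) * N)
          else if (i : ℕ) = f / N + 1 then f - (f / N) * N else 0) i : ℝ) *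
            (1 / 2 : ℝ) ^ (i : ℕ)) =
        (1 / 2 : ℝ) ^ (f / N + 1) * (((f / N : ℕ) + 2) * N - f)) := by
  have hdiv : f / N * N ≤ f := Nat.div_mul_le_self f N
  have hq : f / N ≤ m := Nat.div_le_of_le_mul (by rwa [mul_comm])
  have hy : f / N = m → f - f / N * N = 0 := by
    intro h
    rw [h]
    omega
  have hr : f - f / N * N ≤ N := by
    have hmod := Nat.div_add_mod' f N
    have hmod_lt := Nat.mod_lt f hN
    omega
  generalize f / N = q at *
  obtain ⟨r, rfl⟩ := Nat.exists_eq_add_of_le hdiv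
  simp only [Nat.add_sub_cancel_left] at *
  obtain ⟨s, rfl⟩ := Nat.exists_eq_add_of_le hr
  simp only [Nat.add_sub_cancel_left] at *
  have hcount := sum_two_point_mul (x := s) (fun _ => (1 : ℕ)) hq hy
  have hweight := sum_two_point_mul (x := s) (fun i => i) hq hy
  have heta := sum_two_point_mul (x := s) (fun i => (1 / 2 : ℝ) ^ i) hq hy
  simp only [Nat.cast_id, mul_one] at hcount hweight
  have hcount' := hcount.trans (add_comm s r)
  have hweight' : ∑ i : Fin (m + 1),
      (i : ℕ) * (if (i : ℕ) = q then s else if (i : ℕ) = q + 1 then r else 0) =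
        q * (r + s) + r := by
    refine (Finset.sum_congr rfl fun i _ => mul_comm _ _).trans (hweight.trans ?_)
    ring
  have heta' := heta.trans
    (show _ = (1 / 2 : ℝ) ^ (q + 1) *
      (((q : ℕ) + 2) * ((r + s : ℕ) : ℝ) - ((q * (r + s) + r : ℕ) : ℝ)) by
        push_cast
        ring)
  refine ⟨⟨⟨_, hcount', hweight', heta'.symm⟩, ?_⟩, hcount', hweight', heta'⟩
  rintro _ ⟨a, ha, hw, rfl⟩
  rw [← hw, ← ha]
  push_cast
  calc _ = ∑ i : Fin (m + 1), (a i : ℝ) * ((1 / 2 : ℝ) ^ (q + 1) * ((q : ℝ) + 2 - (i : ℕ))) := by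
        rw [Finset.mul_sum, ← Finset.sum_sub_distrib, Finset.mul_sum]
        exact Finset.sum_congr rfl fun i _ => by ring
    _ ≤ _ := Finset.sum_le_sum fun i _ =>
        mul_le_mul_of_nonneg_left (chord_le_half_pow q i) (Nat.cast_nonneg _)
end

section
/- Let N, K, m, i be integers with m ≥ 1, 1 ≤ i ≤ m, K ≥ 2, and 2^{-i}N + 1 − 2^{-(i+1)} ≤ K < 2^{-(i-1)}N + 1 − 2^{-i}. Then for every vector (a_0, …, a_m) of nonnegative integers with Σ_{j=0}^m a_j = N whose total number of bit erasures f = Σ_{j=0}^m j·a_j satisfies f < (i+1)N − 2^i(K−1), one has η = Σ_{j=0}^m a_j 2^{-j} > K − 1. In particular, every pattern of f bit erasures with f < (i+1)N − 2^i(K−1) is certainly decodable by algebraic soft-decision decoding under PMAS with infinite cost; for rates R ≥ 1/2 + 3/(4N) (i = 1) the radius is f < 2N − 2(K−1). -/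
/-- The line through the points `x = i - 1, i` of the convex function `x ↦ 2 ^ (i - x)` bounds it
from below at every natural number. -/
theorem add_one_sub_le_two_pow_mul_half_pow (i j : ℕ) :
    (i : ℝ) + 1 - j ≤ 2 ^ i * (1 / 2 : ℝ) ^ j := by
  rcases le_or_gt j i with h | h
  · obtain ⟨k, rfl⟩ := Nat.exists_eq_add_of_le h
    have hk : (k : ℝ) + 1 ≤ 2 ^ k := by exact_mod_cast Nat.lt_two_pow_self (n := k)
    have hpow : (2 : ℝ) ^ (j + k) * (1 / 2 : ℝ) ^ j = 2 ^ k := by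
      rw [pow_add, mul_right_comm, ← mul_pow]
      norm_num
    rw [hpow]
    push_cast
    linarith
  · have hij : (i : ℝ) + 1 ≤ j := by exact_mod_cast h
    have hpos : (0 : ℝ) ≤ 2 ^ i * (1 / 2 : ℝ) ^ j := by positivity
    linarith

/-- Bit-level decoding radius of ASD under PMAS with infinite cost over the BEC:
for an (N,K) RS code over GF(2^m) with `2^{-i}N + 1 − 2^{-(i+1)} ≤ K < 2^{-(i-1)}N + 1 − 2^{-i}`,
every erasure pattern `(a_0, …, a_m)` whose total number of bit erasures
`f = Σ j·a_j` satisfies `f < (i+1)N − 2^i(K−1)` has `η = Σ a_j 2^{-j} > K − 1`,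
i.e., it is certainly decodable. -/
theorem bec_decoding_radius (N K m i : ℕ) (hm : 1 ≤ m) (hi1 : 1 ≤ i) (him : i ≤ m)
    (hK : 2 ≤ K)
    (hKlo : (1 / 2 : ℝ) ^ i * N + 1 - (1 / 2 : ℝ) ^ (i + 1) ≤ (K : ℝ))
    (hKhi : (K : ℝ) < (1 / 2 : ℝ) ^ (i - 1) * N + 1 - (1 / 2 : ℝ) ^ i)
    (a : Fin (m + 1) → ℕ) (hsum : (∑ j : Fin (m + 1), a j) = N)
    (hf : ((∑ j : Fin (m + 1), (j : ℕ) * a j : ℕ) : ℝ) <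
      ((i : ℝ) + 1) * N - 2 ^ i * ((K : ℝ) - 1)) :
    (∑ j : Fin (m + 1), (a j : ℝ) * (1 / 2 : ℝ) ^ (j : ℕ)) > (K : ℝ) - 1 := by
  have hbound : ((i : ℝ) + 1) * N - ((∑ j : Fin (m + 1), (j : ℕ) * a j : ℕ) : ℝ) ≤
      2 ^ i * ∑ j : Fin (m + 1), (a j : ℝ) * (1 / 2 : ℝ) ^ (j : ℕ) := by
    rw [← hsum]
    push_cast
    rw [Finset.mul_sum, Finset.mul_sum, ← Finset.sum_sub_distrib]
    refine Finset.sum_le_sum fun j _ => ?_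
    have h := mul_le_mul_of_nonneg_left (add_one_sub_le_two_pow_mul_half_pow i j)
      (Nat.cast_nonneg (α := ℝ) (a j))
    linarith
  refine lt_of_mul_lt_mul_left ?_ (by positivity : (0 : ℝ) ≤ 2 ^ i)
  linarith
end

section
/- Let N ≥ K ≥ 1 and m ≥ 1 be integers. For every vector (a_0, …, a_m) of nonnegative integers with Σ_{i=0}^m a_i = N, if the number of symbols containing at least one erased bit satisfies Σ_{i=1}^m a_i ≥ 2(N−K) + 2, then η = Σ_{i=0}^m a_i 2^{-i} ≤ K − 1. Hence a received word over the binary erasure channel with more than 2(N−K)+1 symbols containing erased bits is not certainly decodable by ASD under PMAS with infinite cost. -/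
/-- If more than `2(N−K)+1` symbols of a received word over the BEC contain erased bits,
then `η = Σ aᵢ 2^{-i} ≤ K − 1`, so the word is not certainly decodable by ASD under
PMAS with infinite cost. -/
theorem bec_not_decodable (N K m : ℕ) (hKN : K ≤ N) (hK : 1 ≤ K) (hm : 1 ≤ m)
    (a : Fin (m + 1) → ℕ) (hsum : (∑ i : Fin (m + 1), a i) = N)
    (herased : 2 * (N - K) + 2 ≤
      ∑ i ∈ Finset.univ.filter (fun i : Fin (m + 1) => (i : ℕ) ≠ 0), a i) :
    (∑ i : Fin (m + 1), (a i : ℝ) * (1 / 2 : ℝ) ^ (i : ℕ)) ≤ (K : ℝ) - 1 := by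
  rw [Finset.sum_filter, Fin.sum_univ_succ] at herased
  rw [Fin.sum_univ_succ] at hsum ⊢
  simp only [Fin.val_zero, Fin.val_succ, ne_eq, not_true_eq_false, if_false, Nat.succ_ne_zero,
    not_false_eq_true, if_true, zero_add, pow_zero, mul_one] at herased ⊢
  have htail : ∑ i : Fin m, (a i.succ : ℝ) * (1 / 2 : ℝ) ^ ((i : ℕ) + 1) ≤
      (∑ i : Fin m, (a i.succ : ℝ)) * (1 / 2) := by
    rw [Finset.sum_mul]
    gcongr with i
    exact pow_le_of_le_one (by norm_num) (by norm_num) (Nat.succ_ne_zero _)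
  have hsum' : (a 0 : ℝ) + ∑ i : Fin m, (a i.succ : ℝ) = N := mod_cast hsum
  have herased' : 2 * ((N : ℝ) - K) + 2 ≤ ∑ i : Fin m, (a i.succ : ℝ) := by
    rw [← Nat.cast_sub hKN]
    exact_mod_cast herased
  linarith
end

section
/- Let u ≥ 1, v ≥ 1, N, K be integers with N ≥ K ≥ 2^{-u}N + 1 + 2^{-2u} − 2^{-u}. Then for every vector (a_0, …, a_v) of nonnegative integers with Σ_{i=0}^v a_i = N whose total number of 2^u-ary erasure events f = Σ_{i=0}^v i·a_i satisfies f < (N − K + 1)/(1 − 2^{-u}), one has η = Σ_{i=0}^v a_i 2^{-iu} > K − 1. That is, ASD under PMAS with infinite cost over the 2^u-ary erasure channel certainly decodes any pattern of fewer than (N−K+1)/(1−2^{-u}) symbol-level erasures. -/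
/-- Over the 2^u-ary erasure channel, ASD under PMAS with infinite cost certainly decodes
any pattern of fewer than `(N−K+1)/(1−2^{-u})` symbol-level erasures: if the erasure
pattern `(a_0, …, a_v)` has `f = Σ i·aᵢ < (N−K+1)/(1−2^{-u})`, then
`η = Σ aᵢ 2^{-iu} > K − 1`. -/
theorem erasure_radius_2u (u v N K : ℕ) (hu : 1 ≤ u) (hv : 1 ≤ v) (hKN : K ≤ N)
    (hK : (1 / 2 : ℝ) ^ u * N + 1 + (1 / 2 : ℝ) ^ (2 * u) - (1 / 2 : ℝ) ^ u ≤ (K : ℝ))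
    (a : Fin (v + 1) → ℕ) (hsum : (∑ i : Fin (v + 1), a i) = N)
    (hf : ((∑ i : Fin (v + 1), (i : ℕ) * a i : ℕ) : ℝ) <
      ((N : ℝ) - K + 1) / (1 - (1 / 2 : ℝ) ^ u)) :
    (∑ i : Fin (v + 1), (a i : ℝ) * (1 / 2 : ℝ) ^ ((i : ℕ) * u)) > (K : ℝ) - 1 := by
  have hq0 : (0 : ℝ) < (1 / 2 : ℝ) ^ u := by positivity
  have hq1 : (1 / 2 : ℝ) ^ u < 1 := pow_lt_one₀ (by norm_num) (by norm_num) (by omega)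
  rw [lt_div_iff₀ (by linarith)] at hf
  have bernoulli (i : ℕ) : 1 - i * (1 - (1 / 2 : ℝ) ^ u) ≤ (1 / 2 : ℝ) ^ (i * u) := by
    have h := one_add_mul_le_pow (show (-2 : ℝ) ≤ (1 / 2 : ℝ) ^ u - 1 by linarith) i
    rw [add_sub_cancel, ← pow_mul, mul_comm u i] at h
    linarith
  have hle : ∑ i : Fin (v + 1), (a i : ℝ) * (1 - (i : ℕ) * (1 - (1 / 2 : ℝ) ^ u)) ≤
      ∑ i : Fin (v + 1), (a i : ℝ) * (1 / 2 : ℝ) ^ ((i : ℕ) * u) :=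
    Finset.sum_le_sum fun i _ => mul_le_mul_of_nonneg_left (bernoulli i) (Nat.cast_nonneg _)
  have heq : ∑ i : Fin (v + 1), (a i : ℝ) * (1 - (i : ℕ) * (1 - (1 / 2 : ℝ) ^ u)) =
      N - ((∑ i : Fin (v + 1), (i : ℕ) * a i : ℕ) : ℝ) * (1 - (1 / 2 : ℝ) ^ u) := by
    rw [← hsum]
    push_cast
    rw [Finset.sum_mul, ← Finset.sum_sub_distrib]
    exact Finset.sum_congr rfl fun i _ => by ring
  linarith
end

section
/- Let N, K, m be integers with 2 ≤ K ≤ N, m ≥ 2 and m(K−1) > N. Let Δ = (m(K−1))² + (N−K+1)(m²(K−1) − mN) and x₀ = (−m(K−1) + √Δ)/(m(m(K−1) − N)). Then √Δ < m(K−1)·(1 + (N−K+1)(m²(K−1) − mN)/(2m²(K−1)²)), hence x₀ < (N−K+1)/(2m(K−1)), and consequently the optimal worst-case bit-level decoding radius satisfies N·m·x₀/(1 + m·x₀) < N(N−K+1)/(N + K − 1). -/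
theorem sqrt_sq_add_lt {A B : ℝ} (hA : 0 < A) (hB : 0 < B) :
    Real.sqrt (A ^ 2 + B) < A + B / (2 * A) := by
  have h : 0 < B / (2 * A) := by positivity
  rw [Real.sqrt_lt' (by positivity)]
  have e : (A + B / (2 * A)) ^ 2 = A ^ 2 + B + (B / (2 * A)) ^ 2 := by
    field_simp
    ring
  rw [e]
  nlinarith [sq_pos_of_pos h]

/-- High-rate approximation of the optimal 1-bit-flipped-BSC radius: with
`Δ = (m(K−1))² + (N−K+1)(m²(K−1) − mN)` and
`x₀ = (−m(K−1) + √Δ)/(m(m(K−1) − N))`, if `m(K−1) > N` then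
`√Δ < m(K−1)(1 + (N−K+1)(m²(K−1) − mN)/(2m²(K−1)²))`, hence
`x₀ < (N−K+1)/(2m(K−1))` and the optimal worst-case bit-level decoding radius
satisfies `N·m·x₀/(1+m·x₀) < N(N−K+1)/(N+K−1)`. -/
theorem high_rate_radius_bound_1bit_bsc (N K m : ℕ) (hK : 2 ≤ K) (hKN : K ≤ N)
    (hm : 2 ≤ m) (hhr : (N : ℝ) < (m : ℝ) * ((K : ℝ) - 1)) :
    Real.sqrt (((m : ℝ) * ((K : ℝ) - 1)) ^ 2 +
        ((N : ℝ) - K + 1) * ((m : ℝ) ^ 2 * ((K : ℝ) - 1) - (m : ℝ) * N)) <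
      (m : ℝ) * ((K : ℝ) - 1) *
        (1 + ((N : ℝ) - K + 1) * ((m : ℝ) ^ 2 * ((K : ℝ) - 1) - (m : ℝ) * N) /
          (2 * (m : ℝ) ^ 2 * ((K : ℝ) - 1) ^ 2)) ∧
    (let x₀ : ℝ := (-((m : ℝ) * ((K : ℝ) - 1)) +
        Real.sqrt (((m : ℝ) * ((K : ℝ) - 1)) ^ 2 +
          ((N : ℝ) - K + 1) * ((m : ℝ) ^ 2 * ((K : ℝ) - 1) - (m : ℝ) * N))) /
        ((m : ℝ) * ((m : ℝ) * ((K : ℝ) - 1) - N));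
      x₀ < ((N : ℝ) - K + 1) / (2 * (m : ℝ) * ((K : ℝ) - 1)) ∧
      (N : ℝ) * (m : ℝ) * x₀ / (1 + (m : ℝ) * x₀) <
        (N : ℝ) * ((N : ℝ) - K + 1) / ((N : ℝ) + K - 1)) := by
  have hK' : (2 : ℝ) ≤ K := by exact_mod_cast hK
  have hKN' : (K : ℝ) ≤ N := by exact_mod_cast hKN
  have hm' : (2 : ℝ) ≤ m := by exact_mod_cast hm
  have hM : (0 : ℝ) < m := by linarith
  have hN : (0 : ℝ) < N := by linarith
  obtain ⟨a, ha⟩ : ∃ a : ℝ, a = (K : ℝ) - 1 := ⟨_, rfl⟩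
  obtain ⟨d, hd⟩ : ∃ d : ℝ, d = (N : ℝ) - K + 1 := ⟨_, rfl⟩
  have hsum : (N : ℝ) + K - 1 = 2 * a + d := by rw [ha, hd]; ring
  rw [hsum, ← hd, ← ha]
  rw [← ha] at hhr
  have ha0 : 0 < a := by linarith
  have hd0 : 0 < d := by linarith
  have hA : 0 < (m : ℝ) * a := by positivity
  have hfac : (m : ℝ) ^ 2 * a - m * N = m * (m * a - N) := by ring
  rw [hfac]
  obtain ⟨E, hE⟩ : ∃ E : ℝ, E = (m : ℝ) * (m * a - N) := ⟨_, rfl⟩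
  have hE0 : 0 < E := hE ▸ mul_pos hM (sub_pos.mpr hhr)
  rw [← hE]
  have hB : 0 < d * E := mul_pos hd0 hE0
  have hlt := sqrt_sq_add_lt hA hB
  have hge : (m : ℝ) * a ≤ Real.sqrt ((m * a) ^ 2 + d * E) :=
    Real.le_sqrt_of_sq_le (by linarith)
  refine ⟨hlt.trans_eq (by field_simp), ?_⟩
  intro x₀
  have hx0 : 0 ≤ x₀ := div_nonneg (by linarith) hE0.le
  have hx : x₀ < d / (2 * m * a) := by
    rw [div_lt_iff₀ hE0]
    have e : d / (2 * m * a) * E = d * E / (2 * (m * a)) := by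
      field_simp
    rw [e]
    linarith
  refine ⟨hx, ?_⟩
  clear_value x₀
  rw [lt_div_iff₀ (by positivity)] at hx
  rw [div_lt_div_iff₀ (by positivity) (by positivity)]
  nlinarith [mul_pos hN (sub_pos.mpr hx)]
end

section
/- Let K, N, f, m, t₁ be real numbers with K ≥ 2, 0 < f < N, 0 < f < 2(K−1), m ≥ 1 and t₁ ≥ 0. Set A = (N−f)(1 + m t₁²) and define h(t₂) = N − f(1 − t₂) − √((K−1)(A + 2f t₂²)) for t₂ ≥ 0. Then h attains its maximum over [0, ∞) uniquely at t₂* = √(A/(4(K−1) − 2f)), and the maximum value is h(t₂*) = N − f − √(((K−1) − f/2)·A). -/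
/-- The weighted sum `f t + (2k - f) s` is strictly below the corresponding weighted quadratic
mean unless `t = s`. -/
theorem add_mul_lt_sqrt_of_ne {k f s t : ℝ} (hf : 0 < f) (hfk : f < 2 * k) (hst : t ≠ s) :
    f * t + (2 * k - f) * s < Real.sqrt (k * ((4 * k - 2 * f) * s ^ 2 + 2 * f * t ^ 2)) := by
  apply Real.lt_sqrt_of_sq_lt
  have hpos : 0 < (2 * k - f) * f * (t - s) ^ 2 :=
    mul_pos (mul_pos (by linarith) hf) (pow_two_pos_of_ne_zero (sub_ne_zero.mpr hst))
  linear_combination hpos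


/-- Optimal erasure multiplicity coefficient over the 1-bit flipped or erased channel:
with `A = (N−f)(1 + m t₁²)` and `h(t₂) = N − f(1−t₂) − √((K−1)(A + 2f t₂²))`, the
function `h` attains its maximum over `[0,∞)` uniquely at `t₂* = √(A/(4(K−1) − 2f))`,
with maximum value `N − f − √(((K−1) − f/2)·A)`. -/
theorem optimal_t2_1bit_flipped_erased (K N f m t₁ : ℝ) (hK : 2 ≤ K)
    (hf0 : 0 < f) (hfN : f < N) (hfK : f < 2 * (K - 1)) (hm : 1 ≤ m) (ht₁ : 0 ≤ t₁) :
    (∀ t₂ : ℝ, 0 ≤ t₂ →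
        t₂ ≠ Real.sqrt ((N - f) * (1 + m * t₁ ^ 2) / (4 * (K - 1) - 2 * f)) →
        N - f * (1 - t₂) -
            Real.sqrt ((K - 1) * ((N - f) * (1 + m * t₁ ^ 2) + 2 * f * t₂ ^ 2)) <
          N - f * (1 - Real.sqrt ((N - f) * (1 + m * t₁ ^ 2) / (4 * (K - 1) - 2 * f))) -
            Real.sqrt ((K - 1) * ((N - f) * (1 + m * t₁ ^ 2) +
              2 * f * Real.sqrt ((N - f) * (1 + m * t₁ ^ 2) /
                (4 * (K - 1) - 2 * f)) ^ 2))) ∧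
    N - f * (1 - Real.sqrt ((N - f) * (1 + m * t₁ ^ 2) / (4 * (K - 1) - 2 * f))) -
        Real.sqrt ((K - 1) * ((N - f) * (1 + m * t₁ ^ 2) +
          2 * f * Real.sqrt ((N - f) * (1 + m * t₁ ^ 2) /
            (4 * (K - 1) - 2 * f)) ^ 2)) =
      N - f - Real.sqrt (((K - 1) - f / 2) * ((N - f) * (1 + m * t₁ ^ 2))) := by
  have hD : 0 < 4 * (K - 1) - 2 * f := by linarith
  have hA : 0 ≤ (N - f) * (1 + m * t₁ ^ 2) :=
    mul_nonneg (by linarith) (by positivity)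
  generalize (N - f) * (1 + m * t₁ ^ 2) = A at hA ⊢
  have hs : 0 ≤ Real.sqrt (A / (4 * (K - 1) - 2 * f)) := Real.sqrt_nonneg _
  have hsq : A = (4 * (K - 1) - 2 * f) * Real.sqrt (A / (4 * (K - 1) - 2 * f)) ^ 2 := by
    rw [Real.sq_sqrt (by positivity)]
    field_simp
  generalize Real.sqrt (A / (4 * (K - 1) - 2 * f)) = s at hs hsq ⊢
  subst hsq
  have hroot : Real.sqrt ((K - 1) * ((4 * (K - 1) - 2 * f) * s ^ 2 + 2 * f * s ^ 2)) =
      2 * (K - 1) * s := by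
    rw [← Real.sqrt_sq (mul_nonneg (by linarith) hs : 0 ≤ 2 * (K - 1) * s)]
    ring_nf
  have hvalue : Real.sqrt ((K - 1 - f / 2) * ((4 * (K - 1) - 2 * f) * s ^ 2)) =
      (2 * (K - 1) - f) * s := by
    rw [← Real.sqrt_sq (mul_nonneg (by linarith) hs : 0 ≤ (2 * (K - 1) - f) * s)]
    ring_nf
  rw [hroot, hvalue]
  refine ⟨fun t _ hts => ?_, by ring⟩
  linear_combination add_mul_lt_sqrt_of_ne hf0 hfK hts
end

section
/- Let K ≥ 2 be an integer, M a positive integer, and S a real number with 0 ≤ S ≤ M(K−1). Then T(S) ≤ ((M+1)/2)·S. Consequently, if the cost satisfies C ≥ ((M+1)/2)·S (as is the case symbol-by-symbol for the proposed multiplicity assignment strategy with multiplicity parameter M), then T(S) ≤ C, i.e., a received word with score S ≤ M(K−1) is not certainly decodable. -/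
/-- The Koetter–Vardy piecewise linear function: `T(S) = 0` for `S ≤ 0` and
`T(S) = (a+1)(S − (a/2)(K−1))` for `a(K−1) < S ≤ (a+1)(K−1)`, where for `S > 0`
we have `a + 1 = ⌈S/(K−1)⌉`. -/
noncomputable def kvT (K : ℕ) (S : ℝ) : ℝ :=
  if S ≤ 0 then 0
  else (⌈S / ((K : ℝ) - 1)⌉ : ℝ) *
    (S - ((⌈S / ((K : ℝ) - 1)⌉ : ℝ) - 1) / 2 * ((K : ℝ) - 1))

/-- On each linear piece, indexed by `⌈S/(K−1)⌉`, the function `T` is bounded by the chord slope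
at the right endpoint of the piece. -/
theorem kvT_le_ceil_mul {K : ℕ} (hK : 2 ≤ K) {S : ℝ} (hS : 0 < S) :
    kvT K S ≤ ((⌈S / ((K : ℝ) - 1)⌉ : ℝ) + 1) / 2 * S := by
  have hK' : (2 : ℝ) ≤ K := by exact_mod_cast hK
  have hL : (0 : ℝ) < (K : ℝ) - 1 := by linarith
  have hc : (1 : ℝ) ≤ (⌈S / ((K : ℝ) - 1)⌉ : ℝ) := by
    exact_mod_cast Int.one_le_ceil_iff.2 (div_pos hS hL)
  have hSc : S ≤ (⌈S / ((K : ℝ) - 1)⌉ : ℝ) * ((K : ℝ) - 1) :=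
    (div_le_iff₀ hL).1 (Int.le_ceil _)
  rw [kvT, if_neg hS.not_ge]
  nlinarith [mul_nonneg (sub_nonneg.2 hc) (sub_nonneg.2 hSc)]

/-- For `0 ≤ S ≤ M(K−1)` we have `T(S) ≤ ((M+1)/2)·S`; consequently any cost
`C ≥ ((M+1)/2)·S` satisfies `T(S) ≤ C`, i.e., a received word with score
`S ≤ M(K−1)` is not certainly decodable. -/
theorem kvT_le_of_small_score (K M : ℕ) (hK : 2 ≤ K) (hM : 0 < M) (S : ℝ)
    (hS0 : 0 ≤ S) (hSM : S ≤ (M : ℝ) * ((K : ℝ) - 1)) :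
    kvT K S ≤ ((M : ℝ) + 1) / 2 * S ∧
    ∀ C : ℝ, ((M : ℝ) + 1) / 2 * S ≤ C → kvT K S ≤ C := by
  suffices h : kvT K S ≤ ((M : ℝ) + 1) / 2 * S from ⟨h, fun _ hC => h.trans hC⟩
  rcases hS0.eq_or_lt with rfl | hS
  · simp [kvT]
  have hK' : (2 : ℝ) ≤ K := by exact_mod_cast hK
  have hL : (0 : ℝ) < (K : ℝ) - 1 := by linarith
  have hcM : (⌈S / ((K : ℝ) - 1)⌉ : ℝ) ≤ M := by
    have h : ⌈S / ((K : ℝ) - 1)⌉ ≤ (M : ℤ) :=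
      Int.ceil_le.2 (by simpa using (div_le_iff₀ hL).2 hSM)
    exact_mod_cast h
  refine (kvT_le_ceil_mul hK hS).trans ?_
  gcongr
end

section
/- Let K ≥ 2 be an integer, M ≥ 2 a positive integer, and S, C real numbers with S > M(K−1) and T(S) > C. Then T(S + M/2) > C + (M² + 2M)/4. (This is the arithmetic content of the statement that recovering one bit-level erasure from an error-free symbol, which increases the score by M/2 and the cost by at most (M²+2M)/4 under the proposed multiplicity assignment strategy, preserves certain decodability.) -/
/-- The linear piece of `kvT` with slope `n` lies below `kvT` at every point to the right
of the interval where it is active. -/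
theorem linear_piece_le_kvT {K : ℕ} (hK : 2 ≤ K) {x : ℝ} (hx : 0 < x) {n : ℤ}
    (hn : n ≤ ⌈x / ((K : ℝ) - 1)⌉) :
    (n : ℝ) * (x - ((n : ℝ) - 1) / 2 * ((K : ℝ) - 1)) ≤ kvT K x := by
  have hL : (0 : ℝ) < (K : ℝ) - 1 := by
    have : (2 : ℝ) ≤ K := by exact_mod_cast hK
    linarith
  rw [kvT, if_neg hx.not_ge]
  have hm : (⌈x / ((K : ℝ) - 1)⌉ : ℝ) - 1 < x / ((K : ℝ) - 1) := by
    linarith [Int.ceil_lt_add_one (x / ((K : ℝ) - 1))]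
  generalize ⌈x / ((K : ℝ) - 1)⌉ = m at hn hm ⊢
  rw [lt_div_iff₀ hL] at hm
  rcases hn.eq_or_lt with rfl | hlt
  · exact le_rfl
  · have hnm : (n : ℝ) + 1 ≤ m := by exact_mod_cast hlt
    have hgap : 0 ≤ x - ((m : ℝ) + n - 1) / 2 * ((K : ℝ) - 1) := by nlinarith
    have hprod := mul_nonneg (by linarith : (0 : ℝ) ≤ m - n) hgap
    linarith

/-- Recovering one bit-level erasure from an error-free symbol preserves certain
decodability: if `S > M(K−1)` and `T(S) > C`, then
`T(S + M/2) > C + (M² + 2M)/4`. -/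
theorem kvT_erasure_recovery (K M : ℕ) (hK : 2 ≤ K) (hM : 2 ≤ M) (S C : ℝ)
    (hS : S > (M : ℝ) * ((K : ℝ) - 1)) (hTC : kvT K S > C) :
    kvT K (S + (M : ℝ) / 2) > C + ((M : ℝ) ^ 2 + 2 * (M : ℝ)) / 4 := by
  have hL : (0 : ℝ) < (K : ℝ) - 1 := by
    have : (2 : ℝ) ≤ K := by exact_mod_cast hK
    linarith
  have hM' : (2 : ℝ) ≤ M := by exact_mod_cast hM
  have hS0 : 0 < S := lt_trans (by positivity) hS
  have hslope : (M : ℝ) + 1 ≤ ⌈S / ((K : ℝ) - 1)⌉ := by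
    have h : (M : ℤ) < ⌈S / ((K : ℝ) - 1)⌉ := by
      rw [Int.lt_ceil, lt_div_iff₀ hL]
      exact_mod_cast hS
    exact_mod_cast h
  have hpiece := linear_piece_le_kvT hK (x := S + (M : ℝ) / 2) (by positivity)
    (n := ⌈S / ((K : ℝ) - 1)⌉) (Int.ceil_le_ceil (by gcongr; linarith))
  rw [kvT, if_neg hS0.not_ge] at hTC
  nlinarith
end

section
/- Let N and K be integers with N + 1 ≥ K ≥ 2 and K − 1 ≥ 2N/3 (i.e., rate R ≥ 2/3 + 1/N), and let e, f be nonnegative real numbers with e < (N − K + 1)/2 − f/3. Then T(2N − 2e − f) > 3N − f. Hence, under the proposed multiplicity assignment strategy with M = 2 (score S = 2(N − e − f/2), cost C = 3N − f), every pattern of e bit errors and f bit erasures with e < (N−K+1)/2 − f/3 is certainly decodable. -/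
/-- Decoding region of the proposed MAS with `M = 2` for high-rate codes
(`K − 1 ≥ 2N/3`): every pattern of `e` bit errors and `f` bit erasures with
`e < (N−K+1)/2 − f/3` satisfies `T(2N − 2e − f) > 3N − f`, i.e., it is certainly
decodable (score `S = 2N − 2e − f`, cost `C = 3N − f`). -/
theorem bgmd_region_M2_high_rate (N K : ℕ) (hK : 2 ≤ K) (hKN : K ≤ N + 1)
    (hrate : 2 * (N : ℝ) / 3 ≤ (K : ℝ) - 1)
    (e f : ℝ) (he : 0 ≤ e) (hf : 0 ≤ f)
    (hef : e < ((N : ℝ) - K + 1) / 2 - f / 3) :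
    kvT K (2 * (N : ℝ) - 2 * e - f) > 3 * (N : ℝ) - f := by
  have hk : (0 : ℝ) < (K : ℝ) - 1 := by
    have : (2 : ℝ) ≤ K := by exact_mod_cast hK
    linarith
  have hkN : (K : ℝ) ≤ N + 1 := by exact_mod_cast hKN
  have hS : ¬ 2 * (N : ℝ) - 2 * e - f ≤ 0 := by
    intro h
    linarith
  have hceil : ⌈(2 * (N : ℝ) - 2 * e - f) / ((K : ℝ) - 1)⌉ = 3 := by
    rw [Int.ceil_eq_iff, lt_div_iff₀ hk, div_le_iff₀ hk]
    push_cast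
    constructor <;> linarith
  rw [kvT, if_neg hS, hceil]
  push_cast
  linarith
end

section
/- Let N ≥ K ≥ 2 be integers, M ≥ 2 an even positive integer, and e, f nonnegative real numbers with e + f ≤ N and f ≤ N. Define the cost C = (N − f)·M(M+1)/2 + f·(M/2)(M/2 + 1) and â = ⌊(−1 + √(1 + 8C/(K−1)))/2⌋. If e < N − f/2 − (â(â+1)(K−1)/2 + C)/(M(â+1)), then T((N − e − f/2)M) > C; that is, every pattern of e bit errors and f bit erasures satisfying this inequality is certainly decodable under the proposed multiplicity assignment strategy with multiplicity parameter M. -/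
/-- Every chord `m * (S - (m - 1) / 2 * (K - 1))` with `m` an integer lies below `kvT K` at
`S > 0`. -/
lemma le_kvT {K : ℕ} (hK : 2 ≤ K) {S : ℝ} (hS : 0 < S) (m : ℤ) :
    (m : ℝ) * (S - ((m : ℝ) - 1) / 2 * ((K : ℝ) - 1)) ≤ kvT K S := by
  have hD : (0 : ℝ) < (K : ℝ) - 1 := by
    have : (2 : ℝ) ≤ K := by exact_mod_cast hK
    linarith
  rw [kvT, if_neg hS.not_ge]
  set D : ℝ := (K : ℝ) - 1
  have h_upper : S ≤ ⌈S / D⌉ * D := (div_le_iff₀ hD).1 (Int.le_ceil _)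
  have h_lower : ((⌈S / D⌉ : ℝ) - 1) * D < S :=
    (lt_div_iff₀ hD).1 (by linarith [Int.ceil_lt_add_one (S / D)])
  generalize ⌈S / D⌉ = n at *
  suffices 0 ≤ ((n : ℝ) - m) * (S - ((n : ℝ) + m - 1) / 2 * D) by linarith
  rcases lt_trichotomy n m with h | rfl | h
  · have h' : (n : ℝ) + 1 ≤ m := by exact_mod_cast h
    refine mul_nonneg_of_nonpos_of_nonpos (by linarith) ?_
    nlinarith
  · simp
  · have h' : (m : ℝ) + 1 ≤ n := by exact_mod_cast h
    refine mul_nonneg (by linarith) ?_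
    nlinarith

/-- Finite-cost decoding region of the proposed MAS with even multiplicity parameter
`M`: with cost `C = (N − f)·M(M+1)/2 + f·(M/2)(M/2 + 1)` and
`â = ⌊(−1 + √(1 + 8C/(K−1)))/2⌋`, every pattern of `e` bit errors and `f` bit
erasures with `e < N − f/2 − (â(â+1)(K−1)/2 + C)/(M(â+1))` satisfies
`T((N − e − f/2)M) > C`, i.e., it is certainly decodable. -/
theorem bgmd_region_finite_M (N K M : ℕ) (hK : 2 ≤ K) (hKN : K ≤ N)
    (hM : 2 ≤ M) (hMeven : Even M)
    (e f : ℝ) (he : 0 ≤ e) (hf : 0 ≤ f) (hefN : e + f ≤ (N : ℝ)) (hfN : f ≤ (N : ℝ)) :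
    let C : ℝ := ((N : ℝ) - f) * M * ((M : ℝ) + 1) / 2 +
      f * ((M : ℝ) / 2) * ((M : ℝ) / 2 + 1)
    let a : ℤ := ⌊(-1 + Real.sqrt (1 + 8 * C / ((K : ℝ) - 1))) / 2⌋
    e < (N : ℝ) - f / 2 -
        ((a : ℝ) * ((a : ℝ) + 1) * ((K : ℝ) - 1) / 2 + C) / ((M : ℝ) * ((a : ℝ) + 1)) →
      kvT K (((N : ℝ) - e - f / 2) * M) > C := by
  intro C a h
  have hD : (0 : ℝ) < (K : ℝ) - 1 := by
    have : (2 : ℝ) ≤ K := by exact_mod_cast hK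
    linarith
  have hM₀ : (0 : ℝ) < M := by exact_mod_cast (by omega : 0 < M)
  have hC : 0 ≤ C := by
    have : 0 ≤ (N : ℝ) - f := by linarith
    positivity
  have ha : 0 ≤ a := by
    refine Int.floor_nonneg.2 ?_
    have : 1 ≤ Real.sqrt (1 + 8 * C / ((K : ℝ) - 1)) :=
      Real.one_le_sqrt.2 (le_add_of_nonneg_right (by positivity))
    linarith
  clear_value C a
  have ha' : (0 : ℝ) ≤ a := by exact_mod_cast ha
  have h_score : (a : ℝ) * (a + 1) * ((K : ℝ) - 1) / 2 + C <
      ((N : ℝ) - e - f / 2) * (M * (a + 1)) :=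
    (div_lt_iff₀ (by positivity)).1 (by linarith)
  have hS : 0 < ((N : ℝ) - e - f / 2) * M := by
    refine pos_of_mul_pos_left (b := (a : ℝ) + 1) ?_ (by linarith)
    have : 0 ≤ (a : ℝ) * (a + 1) * ((K : ℝ) - 1) / 2 + C := by positivity
    linarith
  have h_chord := le_kvT hK hS (a + 1)
  push_cast at h_chord
  linarith
end

section
/- Let K ≥ 2 be an integer, a a positive integer, and x a real number with x ≥ K − 1. Then T((a+1)x) ≥ ((a+2)/a)·T(a·x), where T is the piecewise linear function T(0) = 0, T(S) = (i+1)(S − (i/2)(K−1)) for i(K−1) < S ≤ (i+1)(K−1), i = 0, 1, 2, …. -/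
/-- `kvT K` lies above each of the lines through its linear pieces. -/
theorem line_le_kvT {K : ℕ} (hK : 2 ≤ K) {S : ℝ} (hS : 0 < S) (p : ℤ) :
    (p : ℝ) * (S - ((p : ℝ) - 1) / 2 * ((K : ℝ) - 1)) ≤ kvT K S := by
  have hK' : (2 : ℝ) ≤ K := by exact_mod_cast hK
  have hm : (0 : ℝ) < (K : ℝ) - 1 := by linarith
  rw [kvT, if_neg hS.not_ge]
  have h_upper := (div_le_iff₀ hm).1 (Int.le_ceil (S / ((K : ℝ) - 1)))
  have h_lower := (lt_div_iff₀ hm).1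
    (sub_lt_iff_lt_add.2 (Int.ceil_lt_add_one (S / ((K : ℝ) - 1))))
  generalize ⌈S / ((K : ℝ) - 1)⌉ = c at *
  generalize (K : ℝ) - 1 = m at *
  have key : 0 ≤ ((c : ℝ) - p) * (S - ((c : ℝ) + p - 1) / 2 * m) := by
    rcases lt_trichotomy p c with h | rfl | h
    · have h' : (p : ℝ) + 1 ≤ c := by exact_mod_cast h
      exact mul_nonneg (by linarith) (by nlinarith)
    · simp
    · have h' : (c : ℝ) + 1 ≤ p := by exact_mod_cast h
      exact mul_nonneg_of_nonpos_of_nonpos (by linarith) (by nlinarith)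
  linarith

/-- For every positive integer `a` and real `x ≥ K − 1`,
`T((a+1)x) ≥ ((a+2)/a)·T(a·x)`. -/
theorem kvT_scaling (K : ℕ) (hK : 2 ≤ K) (a : ℕ) (ha : 0 < a) (x : ℝ)
    (hx : (K : ℝ) - 1 ≤ x) :
    kvT K (((a : ℝ) + 1) * x) ≥ (((a : ℝ) + 2) / (a : ℝ)) * kvT K ((a : ℝ) * x) := by
  have hK' : (2 : ℝ) ≤ K := by exact_mod_cast hK
  have hm : (0 : ℝ) < (K : ℝ) - 1 := by linarith
  have ha' : (0 : ℝ) < a := by exact_mod_cast ha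
  have hx0 : 0 < x := hm.trans_le hx
  have h_line := line_le_kvT hK (S := ((a : ℝ) + 1) * x) (by positivity)
    (⌈(a : ℝ) * x / ((K : ℝ) - 1)⌉ + 1)
  refine ge_iff_le.2 (le_trans ?_ h_line)
  rw [kvT, if_neg (by positivity : 0 < (a : ℝ) * x).not_ge, div_mul_eq_mul_div, div_le_iff₀ ha']
  have h_upper := (div_le_iff₀ hm).1 (Int.le_ceil ((a : ℝ) * x / ((K : ℝ) - 1)))
  have h_ceil : (a : ℤ) ≤ ⌈(a : ℝ) * x / ((K : ℝ) - 1)⌉ := by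
    have h : (a : ℝ) ≤ (a : ℝ) * x / ((K : ℝ) - 1) := by
      rw [le_div_iff₀ hm]
      gcongr
    exact_mod_cast h.trans (Int.le_ceil _)
  clear h_line
  generalize ⌈(a : ℝ) * x / ((K : ℝ) - 1)⌉ = n at *
  generalize (K : ℝ) - 1 = m at *
  push_cast
  have key : 0 ≤ ((n : ℝ) * m - a * x) * ((n : ℝ) - a - 1) := by
    rcases h_ceil.eq_or_lt with rfl | h
    · have hax : (a : ℝ) * m ≤ a * x := by gcongr
      push_cast at h_upper ⊢
      rw [le_antisymm h_upper hax]
      simp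
    · have h' : (a : ℝ) + 1 ≤ n := by exact_mod_cast h
      exact mul_nonneg (by linarith) (by linarith)
  linarith
end

section
/- Let K ≥ 2 be an integer, M a positive integer, and S, C real numbers with S > M(K−1) and T(S) > C. Then T((M+2)S/M) ≥ ((M+2)(M+3))/(M(M+1)) · T(S) > ((M+2)(M+3))/(M(M+1)) · C. Consequently, since under the proposed multiplicity assignment strategy the score scales as S(M+2) = ((M+2)/M)·S(M) and the cost satisfies C(M+2) ≤ ((M+2)(M+3))/(M(M+1))·C(M), any received word that is certainly decodable with multiplicity parameter M is certainly decodable with multiplicity parameter M + 2: the decoding region of the proposed MAS is monotonic in M. -/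
/-- The linear function that agrees with the normalized Koetter–Vardy function on `(n - 1, n]`. -/
noncomputable def kvLine (n x : ℝ) : ℝ := n * (x - (n - 1) / 2)

theorem kvLine_le_kvLine_ceil (a : ℤ) (x : ℝ) : kvLine a x ≤ kvLine ⌈x⌉ x := by
  have h1 : x ≤ ⌈x⌉ := Int.le_ceil x
  have h2 : (⌈x⌉ : ℝ) < x + 1 := Int.ceil_lt_add_one x
  unfold kvLine
  generalize ⌈x⌉ = n at *
  rcases lt_trichotomy a n with h | rfl | h
  · have h3 : (a : ℝ) + 1 ≤ n := by exact_mod_cast h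
    nlinarith
  · exact le_rfl
  · have h3 : (n : ℝ) + 1 ≤ a := by exact_mod_cast h
    nlinarith

theorem le_kvLine_ceil (x : ℝ) : x * (x + 1) / 2 ≤ kvLine ⌈x⌉ x := by
  have h1 : x ≤ ⌈x⌉ := Int.le_ceil x
  have h2 : (⌈x⌉ : ℝ) < x + 1 := Int.ceil_lt_add_one x
  unfold kvLine
  nlinarith

theorem kvT_eq_mul_kvLine (K : ℕ) {S : ℝ} (hK : 0 < (K : ℝ) - 1) (hS : 0 < S) :
    kvT K S = ((K : ℝ) - 1) * kvLine ⌈S / ((K : ℝ) - 1)⌉ (S / ((K : ℝ) - 1)) := by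
  rw [kvT, if_neg hS.not_ge, kvLine]
  generalize (⌈S / ((K : ℝ) - 1)⌉ : ℝ) = n
  field_simp

theorem mul_kvLine_ceil_le (M : ℕ) (hM : 0 < M) (x : ℝ) (hx : (M : ℝ) < x) :
    ((M : ℝ) + 2) * ((M : ℝ) + 3) / ((M : ℝ) * ((M : ℝ) + 1)) * kvLine ⌈x⌉ x ≤
      kvLine ⌈((M : ℝ) + 2) * x / M⌉ (((M : ℝ) + 2) * x / M) := by
  have hm : (1 : ℝ) ≤ M := by exact_mod_cast hM
  have hm0 : (0 : ℝ) < M := by linarith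
  have hn : (M : ℤ) + 1 ≤ ⌈x⌉ := Int.lt_ceil.mpr (by exact_mod_cast hx)
  obtain ⟨j, hj⟩ := Int.exists_add_of_le hn
  obtain ⟨u, hu⟩ : ∃ u, u = (⌈x⌉ : ℝ) - x := ⟨_, rfl⟩
  have hu0 : 0 ≤ u := by rw [hu]; linarith [Int.le_ceil x]
  have hu1 : u < 1 := by rw [hu]; linarith [Int.ceil_lt_add_one x]
  have hnj : (⌈x⌉ : ℝ) = M + 1 + j := by exact_mod_cast hj
  obtain rfl : x = M + 1 + j - u := by linarith
  have hline₂ := kvLine_le_kvLine_ceil (⌈(M : ℝ) + 1 + j - u⌉ + 2)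
    (((M : ℝ) + 2) * (M + 1 + j - u) / M)
  have hline₃ := kvLine_le_kvLine_ceil (⌈(M : ℝ) + 1 + j - u⌉ + 3)
    (((M : ℝ) + 2) * (M + 1 + j - u) / M)
  have hquad := le_kvLine_ceil (((M : ℝ) + 2) * (M + 1 + j - u) / M)
  push_cast at hline₂ hline₃
  rw [hnj] at hline₂ hline₃ ⊢
  have hj0 : (0 : ℝ) ≤ j := Nat.cast_nonneg j
  generalize (j : ℝ) = r at *
  generalize (M : ℝ) = m at *
  by_cases h₂ : 0 ≤ r * (u * (2 * m + 4) - (r + 1))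
  · refine le_trans (sub_nonneg.mp ?_) hline₂
    rw [show kvLine (m + 1 + r + 2) ((m + 2) * (m + 1 + r - u) / m) -
        (m + 2) * (m + 3) / (m * (m + 1)) * kvLine (m + 1 + r) (m + 1 + r - u) =
        r * (u * (2 * m + 4) - (r + 1)) / (m * (m + 1)) by
      unfold kvLine; field_simp; ring]
    positivity
  have hu2 : u * (2 * m + 4) < r + 1 := by
    by_contra! h
    exact h₂ (mul_nonneg hj0 (by linarith))
  rcases le_total r m with hr | hr
  · refine le_trans (sub_nonneg.mp ?_) hline₃
    rw [show kvLine (m + 1 + r + 3) ((m + 2) * (m + 1 + r - u) / m) -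
        (m + 2) * (m + 3) / (m * (m + 1)) * kvLine (m + 1 + r) (m + 1 + r - u) =
        (r * (u * (2 * m + 4) - (r + 1)) + (m + 1) * (2 * (r + 1) - (m + 2) * u)) /
          (m * (m + 1)) by
      unfold kvLine; field_simp; ring]
    refine div_nonneg ?_ (by positivity)
    have h₄ : 0 ≤ r * (u * (2 * m + 4)) := by positivity
    have h₅ : 0 ≤ (m - r) * (r + 1) := mul_nonneg (by linarith) (by linarith)
    have h₆ : 0 ≤ (m + 1) * ((r + 1) - (m + 2) * u) :=
      mul_nonneg (by linarith) (by nlinarith)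
    nlinarith
  · refine le_trans (sub_nonneg.mp ?_) hquad
    rw [show (m + 2) * (m + 1 + r - u) / m * ((m + 2) * (m + 1 + r - u) / m + 1) / 2 -
        (m + 2) * (m + 3) / (m * (m + 1)) * kvLine (m + 1 + r) (m + 1 + r - u) =
        (m + 2) * ((m + 1 + r - u) * (r + 1 - u) - m * (m + 3) / 2 * (u * (1 - u))) /
          (m * (m * (m + 1))) by
      unfold kvLine; field_simp; ring]
    refine div_nonneg (mul_nonneg (by positivity) ?_) (by positivity)
    have h₄ : u * (1 - u) ≤ 1 / 4 := by nlinarith [sq_nonneg (u - 1 / 2)]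
    have h₅ : m * (m + 3) / 2 * (u * (1 - u)) ≤ m * (m + 3) / 2 * (1 / 4) := by gcongr
    have h₆ : 2 * m * m ≤ (m + 1 + r - u) * (r + 1 - u) :=
      mul_le_mul (by linarith) (by linarith) hm0.le (by linarith)
    nlinarith

/-- Monotonicity of the proposed MAS in the multiplicity parameter `M`: if
`S > M(K−1)` and `T(S) > C`, then
`T((M+2)S/M) ≥ ((M+2)(M+3))/(M(M+1))·T(S) > ((M+2)(M+3))/(M(M+1))·C`;
since the score scales as `(M+2)/M` and the cost by at most `((M+2)(M+3))/(M(M+1))`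
when `M` is increased to `M+2`, certain decodability is preserved. -/
theorem kvT_monotonicity_in_M (K M : ℕ) (hK : 2 ≤ K) (hM : 0 < M) (S C : ℝ)
    (hS : S > (M : ℝ) * ((K : ℝ) - 1)) (hTC : kvT K S > C) :
    kvT K (((M : ℝ) + 2) * S / (M : ℝ)) ≥
      ((M : ℝ) + 2) * ((M : ℝ) + 3) / ((M : ℝ) * ((M : ℝ) + 1)) * kvT K S ∧
    ((M : ℝ) + 2) * ((M : ℝ) + 3) / ((M : ℝ) * ((M : ℝ) + 1)) * kvT K S >
      ((M : ℝ) + 2) * ((M : ℝ) + 3) / ((M : ℝ) * ((M : ℝ) + 1)) * C := by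
  have hm : (0 : ℝ) < M := by exact_mod_cast hM
  have hK' : (0 : ℝ) < (K : ℝ) - 1 := by
    have : (2 : ℝ) ≤ K := by exact_mod_cast hK
    linarith
  have hS0 : 0 < S := lt_trans (by positivity) hS
  refine ⟨?_, mul_lt_mul_of_pos_left hTC (by positivity)⟩
  rw [kvT_eq_mul_kvLine K hK' hS0, kvT_eq_mul_kvLine K hK' (by positivity), ge_iff_le,
    mul_left_comm, show ((M : ℝ) + 2) * S / M / ((K : ℝ) - 1) =
      ((M : ℝ) + 2) * (S / ((K : ℝ) - 1)) / M by ring]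
  exact mul_le_mul_of_nonneg_left
    (mul_kvLine_ceil_le M hM _ ((lt_div_iff₀ hK').mpr hS)) hK'.le
end
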